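/- Let n ≥ 2 and let D be the linear span (inside C^∞(ℝⁿ,ℂ)) of all smoothing symbols and all classical symbols of non-integer order with constant coefficients on ℝⁿ. Let K be a positive integer with K ≤ n and let ρ₁, ρ₂ : D → ℂ be linear forms with Stokes' property on D (i.e. ρ_k(∂_{ξ_i}τ) = 0 whenever τ ∈ D and ∂_{ξ_i}τ ∈ D, for i = 1,…,n). If ρ₁(σ) = ρ₂(σ) for every element σ of D that is a classical symbol of order with real part < −K, then ρ₁ = ρ₂ on all of D. In other words, a closed linear form on non-integer order symbols is entirely determined by its restriction to symbols of arbitrarily negative order. -/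

import Mathlib

open MeasureTheory Metric Filter Complex
open scoped Topology RealInnerProductSpace Classical

noncomputable section

/-- ℝⁿ with the euclidean norm. -/
abbrev Euc (n : ℕ) := EuclideanSpace ℝ (Fin n)

/-- Partial derivative in the `i`-th coordinate direction. -/
def pd {n : ℕ} (i : Fin n) (f : Euc n → ℂ) : Euc n → ℂ :=
  fun ξ => fderiv ℝ f ξ (EuclideanSpace.single i 1)

/-- Iterated partial derivatives along a list of coordinate directions
(a multi-index `β` corresponds to the lists containing `i` exactly `β i` times). -/
def pdIter {n : ℕ} : List (Fin n) → (Euc n → ℂ) → (Euc n → ℂ)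
  | [], f => f
  | i :: L, f => pd i (pdIter L f)

/-- A smooth cut-off function vanishing near `0` and equal to `1` outside the unit ball. -/
structure IsCutoff {n : ℕ} (χ : Euc n → ℝ) : Prop where
  smooth : ContDiff ℝ (⊤ : ℕ∞) χ
  zero_near : ∃ ε > (0:ℝ), ∀ ξ : Euc n, ‖ξ‖ < ε → χ ξ = 0
  one_far : ∀ ξ : Euc n, 1 ≤ ‖ξ‖ → χ ξ = 1

/-- `σ` is a classical symbol of order `a` with constant coefficients on `ℝⁿ`, with
homogeneous components `σc j` of degree `a - j`. -/
structure IsCS {n : ℕ} (χ : Euc n → ℝ) (a : ℂ) (σ : Euc n → ℂ)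
    (σc : ℕ → Euc n → ℂ) : Prop where
  smooth : ContDiff ℝ (⊤ : ℕ∞) σ
  comp_smooth : ∀ j, ContDiffOn ℝ (⊤ : ℕ∞) (σc j) {(0 : Euc n)}ᶜ
  comp_homog : ∀ (j : ℕ) (t : ℝ), 0 < t → ∀ ξ : Euc n, ξ ≠ 0 →
    σc j (t • ξ) = (t : ℂ) ^ (a - j) * σc j ξ
  estimate : ∀ (N : ℕ) (L : List (Fin n)), ∃ C > (0:ℝ), ∀ ξ : Euc n,
    ‖pdIter L (fun η => σ η - ∑ j ∈ Finset.range N, (χ η : ℂ) * σc j η) ξ‖ ≤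
      C * (1 + ‖ξ‖) ^ (a.re - N - L.length : ℝ)

/-- A smoothing symbol with constant coefficients on `ℝⁿ`. -/
def IsSmoothing {n : ℕ} (σ : Euc n → ℂ) : Prop :=
  ContDiff ℝ (⊤ : ℕ∞) σ ∧
    ∀ (L : List (Fin n)) (M : ℝ), 0 < M → ∃ C > (0:ℝ), ∀ ξ : Euc n,
      ‖pdIter L σ ξ‖ ≤ C * (1 + ‖ξ‖) ^ (-M)

/-- The surface measure on the unit sphere `S^{n-1} ⊂ ℝⁿ`. -/
def sphMeas (n : ℕ) : Measure (sphere (0 : Euc n) 1) :=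
  (volume : Measure (Euc n)).toSphere

/-- The integral of a homogeneous component over the unit sphere. -/
def sphInt {n : ℕ} (f : Euc n → ℂ) : ℂ :=
  ∫ ω : sphere (0 : Euc n) 1, f ↑ω ∂(sphMeas n)

/-- The noncommutative residue of a classical symbol of order `a` with homogeneous
components `σc j` of degree `a - j`. -/
def resCC {n : ℕ} (a : ℂ) (σc : ℕ → Euc n → ℂ) : ℂ :=
  if h : ∃ j : ℕ, a - j = -(n : ℂ) then
    (((2 * Real.pi) ^ (-(n : ℝ) / 2) : ℝ) : ℂ) * sphInt (σc h.choose)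
  else 0

/-- The cut-off regularised integral of a classical symbol of order `a` with homogeneous
components `σc`, computed with an integer `N` such that `Re a - N < -n`. -/
def cutoffInt {n : ℕ} (χ : Euc n → ℝ) (a : ℂ) (σ : Euc n → ℂ)
    (σc : ℕ → Euc n → ℂ) (N : ℕ) : ℂ :=
  (∫ ξ : Euc n, (σ ξ - ∑ j ∈ Finset.range N, (χ ξ : ℂ) * σc j ξ))
  + ∑ j ∈ Finset.range N, ∫ ξ in Metric.ball (0 : Euc n) 1, (χ ξ : ℂ) * σc j ξ
  - ∑ j ∈ Finset.range N,
      if a - j + n ≠ 0 then (a - j + n)⁻¹ * sphInt (σc j) else 0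


/-- The linear span of all smoothing symbols and all non-integer order classical symbols
with constant coefficients on `ℝⁿ`. -/
def Dni (n : ℕ) (χ : Euc n → ℝ) : Submodule ℂ (Euc n → ℂ) :=
  Submodule.span ℂ
    {σ | IsSmoothing σ ∨ ∃ a σc, IsCS χ a σ σc ∧ ¬∃ m : ℤ, a = m}

/-- `g` is positively homogeneous of degree `b` outside the unit ball. -/
def HomogAtInfty {n : ℕ} (b : ℂ) (g : Euc n → ℂ) : Prop :=
  ∀ (ξ : Euc n) (t : ℝ), 0 < t → 1 < ‖ξ‖ → 1 < ‖t • ξ‖ → g (t • ξ) = (t : ℂ) ^ b * g ξ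

lemma ContDiff.partialDeriv {n : ℕ} {g : Euc n → ℂ} (hg : ContDiff ℝ (⊤ : ℕ∞) g) (i : Fin n) :
    ContDiff ℝ (⊤ : ℕ∞) (pd i g) :=
  (hg.fderiv_right (m := (⊤ : ℕ∞)) (by simp)).clm_apply contDiff_const

lemma ContDiff.iteratedPartialDeriv {n : ℕ} {g : Euc n → ℂ} (hg : ContDiff ℝ (⊤ : ℕ∞) g)
    (L : List (Fin n)) : ContDiff ℝ (⊤ : ℕ∞) (pdIter L g) := by
  induction L with
  | nil => exact hg
  | cons i L ih => exact ih.partialDeriv i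

lemma HomogAtInfty.partialDeriv {n : ℕ} {b : ℂ} {g : Euc n → ℂ} (hg : ContDiff ℝ (⊤ : ℕ∞) g)
    (h : HomogAtInfty b g) (i : Fin n) : HomogAtInfty (b - 1) (pd i g) := by
  intro ξ t ht hξ htξ
  have hd : Differentiable ℝ g := hg.differentiable (by simp)
  have hev : (fun η : Euc n => g (t • η)) =ᶠ[𝓝 ξ] fun η => (t : ℂ) ^ b * g η := by
    have h1 : ∀ᶠ η : Euc n in 𝓝 ξ, 1 < ‖η‖ :=
      continuous_norm.continuousAt.eventually (lt_mem_nhds hξ)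
    have h2 : ∀ᶠ η : Euc n in 𝓝 ξ, 1 < ‖t • η‖ :=
      (continuous_const_smul t).norm.continuousAt.eventually (lt_mem_nhds htξ)
    filter_upwards [h1, h2] with η h1 h2 using h η t ht h1 h2
  have h3 := congrArg (fun A : Euc n →L[ℝ] ℂ => A (EuclideanSpace.single i (1 : ℝ))) hev.fderiv_eq
  rw [fderiv_comp_smul, fderiv_const_mul (hd ξ) ((t : ℂ) ^ b)] at h3
  simp only [_root_.smul_apply, Complex.real_smul, smul_eq_mul] at h3
  have ht' : (t : ℂ) ≠ 0 := by exact_mod_cast ht.ne'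
  simp only [pd]
  rw [Complex.cpow_sub _ _ ht', Complex.cpow_one, div_mul_eq_mul_div, ← h3]
  field_simp

lemma HomogAtInfty.iteratedPartialDeriv {n : ℕ} {b : ℂ} {g : Euc n → ℂ} (hg : ContDiff ℝ (⊤ : ℕ∞) g)
    (h : HomogAtInfty b g) (L : List (Fin n)) :
    HomogAtInfty (b - L.length) (pdIter L g) := by
  induction L with
  | nil => simpa [pdIter] using h
  | cons i L ih =>
    have := ih.partialDeriv (hg.iteratedPartialDeriv L) i
    rw [sub_sub] at this
    simpa [pdIter] using this

lemma HomogAtInfty.exists_bound {n : ℕ} {b : ℂ} {g : Euc n → ℂ} (hg : Continuous g)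
    (h : HomogAtInfty b g) :
    ∃ C > (0 : ℝ), ∀ ξ : Euc n, ‖g ξ‖ ≤ C * (1 + ‖ξ‖) ^ b.re := by
  obtain ⟨M, hM⟩ := (isCompact_closedBall (0 : Euc n) 2).exists_bound_of_continuousOn
    hg.continuousOn
  have hM0 : 0 ≤ M := (norm_nonneg _).trans (hM 0 (by simp))
  have key : ∀ u : ℝ, 1 ≤ u → u ≤ 3 → 1 ≤ (3 : ℝ) ^ |b.re| * u ^ b.re := by
    intro u hu hu3
    calc (1 : ℝ) ≤ u ^ (|b.re| + b.re) :=
          Real.one_le_rpow hu (by linarith [neg_abs_le b.re])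
      _ = u ^ |b.re| * u ^ b.re := Real.rpow_add (by linarith) _ _
      _ ≤ _ := by gcongr
  have hbound : ∀ ξ : Euc n, ‖g ξ‖ ≤ M * (3 : ℝ) ^ |b.re| * (1 + ‖ξ‖) ^ b.re := by
    intro ξ
    have hn := norm_nonneg ξ
    rcases le_or_gt ‖ξ‖ 2 with hξ | hξ
    · have := key (1 + ‖ξ‖) (by linarith) (by linarith)
      calc ‖g ξ‖ ≤ M := hM ξ (by simpa using hξ)
        _ ≤ M * ((3 : ℝ) ^ |b.re| * (1 + ‖ξ‖) ^ b.re) := le_mul_of_one_le_right hM0 this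
        _ = _ := by ring
    · set t := ‖ξ‖ / 2 with ht
      have ht1 : 1 < t := by rw [ht]; linarith
      have ht0 : 0 < t := by linarith
      have hη : ‖t⁻¹ • ξ‖ = 2 := by
        rw [norm_smul, norm_inv, Real.norm_of_nonneg ht0.le, ht]
        field_simp
      have hξt : t • t⁻¹ • ξ = ξ := smul_inv_smul₀ ht0.ne' ξ
      have h1 := h (t⁻¹ • ξ) t ht0 (by rw [hη]; norm_num) (by rw [hξt]; linarith)
      rw [hξt] at h1
      have h2 := key ((1 + ‖ξ‖) / t) (by rw [le_div_iff₀ ht0, ht]; linarith)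
        (by rw [div_le_iff₀ ht0, ht]; linarith)
      rw [Real.div_rpow (by linarith) ht0.le] at h2
      have hp : 0 < t ^ b.re := Real.rpow_pos_of_pos ht0 _
      rw [← mul_div_assoc, le_div_iff₀ hp, one_mul] at h2
      rw [h1, norm_mul, Complex.norm_cpow_eq_rpow_re_of_pos ht0]
      calc t ^ b.re * ‖g (t⁻¹ • ξ)‖
          ≤ ((3 : ℝ) ^ |b.re| * (1 + ‖ξ‖) ^ b.re) * M := by
            gcongr
            exact hM _ (by simpa using hη.le)
        _ = _ := by ring
  refine ⟨M * (3 : ℝ) ^ |b.re| + 1, by positivity, fun ξ => (hbound ξ).trans ?_⟩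
  gcongr
  linarith

lemma HomogAtInfty.estimate {n : ℕ} {b : ℂ} {g : Euc n → ℂ} (hg : ContDiff ℝ (⊤ : ℕ∞) g)
    (h : HomogAtInfty b g) (L : List (Fin n)) :
    ∃ C > (0 : ℝ), ∀ ξ : Euc n, ‖pdIter L g ξ‖ ≤ C * (1 + ‖ξ‖) ^ (b.re - L.length) := by
  simpa using (h.iteratedPartialDeriv hg L).exists_bound (hg.iteratedPartialDeriv L).continuous

lemma homogAtInfty_of_eq_zero {n : ℕ} {g : Euc n → ℂ} (h0 : ∀ ξ : Euc n, 1 < ‖ξ‖ → g ξ = 0)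
    (b : ℂ) : HomogAtInfty b g := fun ξ t _ hξ htξ => by
  rw [h0 _ hξ, h0 _ htξ, mul_zero]

lemma isSmoothing_of_eq_zero {n : ℕ} {g : Euc n → ℂ} (hg : ContDiff ℝ (⊤ : ℕ∞) g)
    (h0 : ∀ ξ : Euc n, 1 < ‖ξ‖ → g ξ = 0) : IsSmoothing g := by
  refine ⟨hg, fun L M _ => ?_⟩
  simpa using (homogAtInfty_of_eq_zero h0 ((-M + L.length : ℝ) : ℂ)).estimate hg L

lemma IsSmoothing.isCS {n : ℕ} {χ : Euc n → ℝ} {σ : Euc n → ℂ} (h : IsSmoothing σ) {a : ℂ}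
    (ha : a.re < 0) : IsCS χ a σ (fun _ _ => 0) where
  smooth := h.1
  comp_smooth _ := contDiffOn_const
  comp_homog _ _ _ _ _ := by simp
  estimate N L := by
    obtain ⟨C, hC, hb⟩ := h.2 L (-(a.re - N - L.length)) (by
      have h1 : (0 : ℝ) ≤ N := N.cast_nonneg
      have h2 : (0 : ℝ) ≤ L.length := L.length.cast_nonneg
      linarith)
    refine ⟨C, hC, fun ξ => ?_⟩
    simpa using hb ξ

lemma IsCutoff.contDiff_mul {n : ℕ} {χ : Euc n → ℝ} (hχ : IsCutoff χ) {f : Euc n → ℂ}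
    (hf : ContDiffOn ℝ (⊤ : ℕ∞) f {(0 : Euc n)}ᶜ) :
    ContDiff ℝ (⊤ : ℕ∞) (fun ξ => (χ ξ : ℂ) * f ξ) := by
  rw [contDiff_iff_contDiffAt]
  intro ξ
  by_cases hξ : ξ = 0
  · obtain ⟨ε, hε, h0⟩ := hχ.zero_near
    have hev : (fun ξ => (χ ξ : ℂ) * f ξ) =ᶠ[𝓝 ξ] fun _ => 0 := by
      subst hξ
      filter_upwards [Metric.ball_mem_nhds (0 : Euc n) hε] with η hη
      rw [h0 η (by simpa using hη)]
      simp
    exact contDiffAt_const.congr_of_eventuallyEq hev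
  · exact (Complex.ofRealCLM.contDiff.comp hχ.smooth).contDiffAt.mul
      (hf.contDiffAt (isOpen_compl_singleton.mem_nhds hξ))

/-- The homogeneous function of degree `b` agreeing with `g` on the sphere of radius `2`. -/
def homogExt {n : ℕ} (b : ℂ) (g : Euc n → ℂ) : Euc n → ℂ :=
  fun ξ => Complex.exp (b * (Real.log (‖ξ‖ / 2) : ℂ)) * g ((‖ξ‖ / 2)⁻¹ • ξ)

lemma exp_mul_log_eq_cpow {t : ℝ} (ht : 0 < t) (b : ℂ) :
    Complex.exp (b * (Real.log t : ℂ)) = (t : ℂ) ^ b := by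
  rw [Complex.cpow_def_of_ne_zero (by exact_mod_cast ht.ne'), Complex.ofReal_log ht.le, mul_comm]

lemma contDiffOn_homogExt {n : ℕ} (b : ℂ) {g : Euc n → ℂ} (hg : ContDiff ℝ (⊤ : ℕ∞) g) :
    ContDiffOn ℝ (⊤ : ℕ∞) (homogExt b g) {(0 : Euc n)}ᶜ := by
  intro ξ hξ
  have hξ : ξ ≠ 0 := hξ
  have hn : ContDiffAt ℝ (⊤ : ℕ∞) (fun η : Euc n => ‖η‖ / 2) ξ :=
    (contDiffAt_norm ℝ hξ).div_const 2
  have h0 : ‖ξ‖ / 2 ≠ 0 := by simpa using hξ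
  refine ContDiffAt.contDiffWithinAt (ContDiffAt.mul ?_ ?_)
  · exact (contDiffAt_const.mul
      (Complex.ofRealCLM.contDiff.contDiffAt.comp ξ (hn.log h0))).cexp
  · exact hg.contDiffAt.comp ξ ((hn.inv h0).smul contDiffAt_id)

lemma homogExt_smul {n : ℕ} (b : ℂ) (g : Euc n → ℂ) {t : ℝ} (ht : 0 < t) {ξ : Euc n}
    (hξ : ξ ≠ 0) : homogExt b g (t • ξ) = (t : ℂ) ^ b * homogExt b g ξ := by
  have hn : 0 < ‖ξ‖ := norm_pos_iff.2 hξ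
  have h1 : ‖t • ξ‖ / 2 = t * (‖ξ‖ / 2) := by
    rw [norm_smul, Real.norm_of_nonneg ht.le, mul_div_assoc]
  have h2 : (t * (‖ξ‖ / 2))⁻¹ • t • ξ = (‖ξ‖ / 2)⁻¹ • ξ := by
    rw [smul_smul]
    congr 1
    field_simp
  rw [homogExt, homogExt, h1, h2, Real.log_mul ht.ne' (by positivity), Complex.ofReal_add,
    mul_add, Complex.exp_add, exp_mul_log_eq_cpow ht, mul_assoc]

lemma HomogAtInfty.homogExt_eq {n : ℕ} {b : ℂ} {g : Euc n → ℂ} (h : HomogAtInfty b g)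
    {ξ : Euc n} (hξ : 1 < ‖ξ‖) : homogExt b g ξ = g ξ := by
  have ht : 0 < ‖ξ‖ / 2 := by linarith
  have hη : ‖(‖ξ‖ / 2)⁻¹ • ξ‖ = 2 := by
    rw [norm_smul, norm_inv, Real.norm_of_nonneg ht.le]
    field_simp
  have hs : (‖ξ‖ / 2) • (‖ξ‖ / 2)⁻¹ • ξ = ξ := smul_inv_smul₀ ht.ne' ξ
  have h1 := h ((‖ξ‖ / 2)⁻¹ • ξ) (‖ξ‖ / 2) ht (by rw [hη]; norm_num) (by rwa [hs])
  rw [hs] at h1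
  rw [homogExt, exp_mul_log_eq_cpow ht, ← h1]

lemma HomogAtInfty.isCS {n : ℕ} {χ : Euc n → ℝ} (hχ : IsCutoff χ) {b : ℂ} {g : Euc n → ℂ}
    (hg : ContDiff ℝ (⊤ : ℕ∞) g) (h : HomogAtInfty b g) :
    IsCS χ b g (fun j => if j = 0 then homogExt b g else 0) where
  smooth := hg
  comp_smooth j := by
    split_ifs
    · exact contDiffOn_homogExt b hg
    · exact contDiffOn_const
  comp_homog j t ht ξ hξ := by
    split_ifs with hj
    · simpa [hj] using homogExt_smul b g ht hξ
    · simp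
  estimate N L := by
    rcases N with _ | N
    · simpa using h.estimate hg L
    · have hsum : (fun η => g η - ∑ j ∈ Finset.range (N + 1),
          (χ η : ℂ) * (if j = 0 then homogExt b g else 0) η) =
          fun η => g η - (χ η : ℂ) * homogExt b g η := by
        funext η
        rw [Finset.sum_eq_single_of_mem 0 (by simp) (by intro j _ hj; simp [hj])]
        simp
      rw [hsum]
      have hz : ∀ ξ : Euc n, 1 < ‖ξ‖ → g ξ - (χ ξ : ℂ) * homogExt b g ξ = 0 := by
        intro ξ hξ
        rw [hχ.one_far ξ hξ.le, h.homogExt_eq hξ]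
        simp
      simpa using (homogAtInfty_of_eq_zero hz (b - (N + 1 : ℕ))).estimate
        (hg.sub (hχ.contDiff_mul (contDiffOn_homogExt b hg))) L

lemma HomogAtInfty.mem_Dni {n : ℕ} {χ : Euc n → ℝ} (hχ : IsCutoff χ) {b : ℂ} {g : Euc n → ℂ}
    (hg : ContDiff ℝ (⊤ : ℕ∞) g) (h : HomogAtInfty b g) (hb : ¬∃ m : ℤ, b = m) :
    g ∈ Dni n χ :=
  Submodule.subset_span (Or.inr ⟨b, _, h.isCS hχ hg, hb⟩)

lemma HomogAtInfty.coord_mul {n : ℕ} {b : ℂ} {g : Euc n → ℂ} (h : HomogAtInfty b g)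
    (i : Fin n) : HomogAtInfty (b + 1) (fun ξ => (ξ i : ℂ) * g ξ) := by
  intro ξ t ht hξ htξ
  have ht' : (t : ℂ) ≠ 0 := by exact_mod_cast ht.ne'
  simp only [PiLp.smul_apply, smul_eq_mul, Complex.ofReal_mul]
  rw [h ξ t ht hξ htξ, Complex.cpow_add _ _ ht', Complex.cpow_one]
  ring

lemma contDiff_coord_mul {n : ℕ} {g : Euc n → ℂ} (hg : ContDiff ℝ (⊤ : ℕ∞) g) (i : Fin n) :
    ContDiff ℝ (⊤ : ℕ∞) (fun ξ => (ξ i : ℂ) * g ξ) :=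
  (Complex.ofRealCLM.contDiff.comp (EuclideanSpace.proj (𝕜 := ℝ) i).contDiff).mul hg

lemma pd_coord_mul {n : ℕ} {g : Euc n → ℂ} (hg : Differentiable ℝ g) (i : Fin n) (ξ : Euc n) :
    pd i (fun ξ => (ξ i : ℂ) * g ξ) ξ = g ξ + (ξ i : ℂ) * pd i g ξ := by
  have hc : HasFDerivAt (fun ξ : Euc n => (ξ i : ℂ))
      (Complex.ofRealCLM.comp (EuclideanSpace.proj (𝕜 := ℝ) i)) ξ :=
    (Complex.ofRealCLM.comp (EuclideanSpace.proj (𝕜 := ℝ) i)).hasFDerivAt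
  have hm : HasFDerivAt (fun ξ : Euc n => (ξ i : ℂ) * g ξ) _ ξ := hc.mul (hg ξ).hasFDerivAt
  rw [pd, hm.fderiv]
  simp [pd, add_comm]

/-- Euler's identity for functions homogeneous at infinity. -/
lemma HomogAtInfty.euler {n : ℕ} {b : ℂ} {g : Euc n → ℂ} (hg : Differentiable ℝ g)
    (h : HomogAtInfty b g) {ξ : Euc n} (hξ : 1 < ‖ξ‖) :
    ∑ i, (ξ i : ℂ) * pd i g ξ = b * g ξ := by
  have h1 : ∑ i, (ξ i : ℂ) * pd i g ξ = fderiv ℝ g ξ ξ := by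
    have h0 := congrArg (fderiv ℝ g ξ) ((EuclideanSpace.basisFun (Fin n) ℝ).sum_repr ξ)
    rw [map_sum] at h0
    simpa [pd] using h0
  have hs : HasDerivAt (fun t : ℝ => t • ξ) ξ 1 := by
    simpa using (hasDerivAt_id (1 : ℝ)).smul_const ξ
  have hg1 : HasFDerivAt g (fderiv ℝ g ξ) ((1 : ℝ) • ξ) := by
    simpa using (hg ξ).hasFDerivAt
  have h2 : HasDerivAt (fun t : ℝ => g (t • ξ)) (fderiv ℝ g ξ ξ) 1 :=
    hg1.comp_hasDerivAt 1 hs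
  have hexp : HasDerivAt (fun t : ℝ => Complex.exp (b * (Real.log t : ℂ)) * g ξ)
      (b * g ξ) 1 := by
    have := (((Real.hasDerivAt_log one_ne_zero).ofReal_comp.const_mul b).cexp).mul_const (g ξ)
    simpa using this
  have hev : (fun t : ℝ => g (t • ξ)) =ᶠ[𝓝 1]
      fun t : ℝ => Complex.exp (b * (Real.log t : ℂ)) * g ξ := by
    have h3 : ∀ᶠ t : ℝ in 𝓝 1, 1 < ‖t • ξ‖ :=
      (continuous_id.smul continuous_const).norm.continuousAt.eventually
        (lt_mem_nhds (by simpa using hξ))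
    filter_upwards [h3, lt_mem_nhds one_pos] with t h3 ht
    rw [exp_mul_log_eq_cpow ht, h ξ t ht hξ h3]
  rw [h1]
  exact h2.unique (hexp.congr_of_eventuallyEq hev)

/-- A closed linear form vanishing on smoothing symbols vanishes on symbols which are homogeneous
of non-integer degree at infinity. -/
lemma HomogAtInfty.closed_form_eq_zero {n : ℕ} {χ : Euc n → ℝ} (hχ : IsCutoff χ)
    (ρ : Dni n χ →ₗ[ℂ] ℂ)
    (hst : ∀ (τ σ : Dni n χ) (i : Fin n),
      (σ : Euc n → ℂ) = pd i (τ : Euc n → ℂ) → ρ σ = 0)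
    (hsm : ∀ σ : Dni n χ, IsSmoothing (σ : Euc n → ℂ) → ρ σ = 0)
    {b : ℂ} {g : Euc n → ℂ} (hg : ContDiff ℝ (⊤ : ℕ∞) g) (h : HomogAtInfty b g)
    (hb : ¬∃ m : ℤ, b = m) (hgD : g ∈ Dni n χ) : ρ ⟨g, hgD⟩ = 0 := by
  have hd : Differentiable ℝ g := hg.differentiable (by simp)
  have hb1 : ¬∃ m : ℤ, b + 1 = m := fun ⟨m, hm⟩ =>
    hb ⟨m - 1, by push_cast; rw [← hm]; ring⟩
  have hbn : b + n ≠ 0 := fun h0 => hb ⟨-n, by push_cast; linear_combination h0⟩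
  have hτs := fun i => contDiff_coord_mul hg i
  have hτh := fun i => h.coord_mul i
  have hτD := fun i => (hτh i).mem_Dni hχ (hτs i) hb1
  have hσh : ∀ i, HomogAtInfty b (pd i (fun ξ => (ξ i : ℂ) * g ξ)) := fun i => by
    simpa using (hτh i).partialDeriv (hτs i) i
  have hσD := fun i => (hσh i).mem_Dni hχ ((hτs i).partialDeriv i) hb
  let s : Dni n χ := ∑ i, ⟨_, hσD i⟩
  have hs : (s : Euc n → ℂ) =
      fun ξ => ∑ i, pd i (fun ξ => (ξ i : ℂ) * g ξ) ξ := by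
    funext ξ
    simp [s]
  have hρs : ρ s = 0 := by
    simp only [s, map_sum]
    exact Finset.sum_eq_zero fun i _ => hst ⟨_, hτD i⟩ _ i rfl
  have hr : IsSmoothing (((b + n) • (⟨g, hgD⟩ : Dni n χ) - s : Dni n χ) : Euc n → ℂ) := by
    have hcoe : (((b + n) • (⟨g, hgD⟩ : Dni n χ) - s : Dni n χ) : Euc n → ℂ) =
        fun ξ => (b + n) * g ξ - ∑ i, pd i (fun ξ => (ξ i : ℂ) * g ξ) ξ := by
      funext ξ
      simp [hs]
    rw [hcoe]
    refine isSmoothing_of_eq_zero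
      ((contDiff_const.mul hg).sub (ContDiff.sum fun i _ => (hτs i).partialDeriv i)) fun ξ hξ => ?_
    simp only [pd_coord_mul hd, Finset.sum_add_distrib, h.euler hd hξ]
    simp
    ring
  have hρ := hsm _ hr
  rw [map_sub, hρs, sub_zero, map_smul, smul_eq_mul] at hρ
  exact (mul_eq_zero.1 hρ).resolve_left hbn

lemma IsCS.homogAtInfty_comp {n : ℕ} {χ : Euc n → ℝ} (hχ : IsCutoff χ) {a : ℂ} {σ : Euc n → ℂ}
    {σc : ℕ → Euc n → ℂ} (h : IsCS χ a σ σc) (j : ℕ) :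
    HomogAtInfty (a - j) (fun ξ => (χ ξ : ℂ) * σc j ξ) := by
  intro ξ t ht hξ htξ
  have h0 : ξ ≠ 0 := norm_pos_iff.1 (by linarith)
  simp only [hχ.one_far ξ hξ.le, hχ.one_far _ htξ.le, h.comp_homog j t ht ξ h0]
  simp

lemma IsCS.remainder {n : ℕ} {χ : Euc n → ℝ} (hχ : IsCutoff χ) {a : ℂ} {σ : Euc n → ℂ}
    {σc : ℕ → Euc n → ℂ} (h : IsCS χ a σ σc) (N : ℕ) :
    IsCS χ (a - N) (fun ξ => σ ξ - ∑ j ∈ Finset.range N, (χ ξ : ℂ) * σc j ξ)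
      (fun j => σc (N + j)) where
  smooth := h.smooth.sub (ContDiff.sum fun j _ => hχ.contDiff_mul (h.comp_smooth j))
  comp_smooth j := h.comp_smooth (N + j)
  comp_homog j t ht ξ hξ := by
    rw [h.comp_homog (N + j) t ht ξ hξ]
    push_cast
    rw [sub_sub]
  estimate M L := by
    obtain ⟨C, hC, hb⟩ := h.estimate (N + M) L
    refine ⟨C, hC, fun ξ => ?_⟩
    simp only [Finset.sum_range_add, ← sub_sub, Nat.cast_add] at hb
    simpa using hb ξ

lemma not_int_sub_natCast {a : ℂ} (ha : ¬∃ m : ℤ, a = m) (j : ℕ) : ¬∃ m : ℤ, a - j = m :=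
  fun ⟨m, hm⟩ => ha ⟨m + j, by push_cast; linear_combination hm⟩

/-- A closed linear form on non-integer order symbols is entirely determined by its
restriction to symbols of order of real part `< -K`. -/
theorem closed_form_determined_nonint {n : ℕ} (hn : 2 ≤ n) {χ : Euc n → ℝ}
    (hχ : IsCutoff χ) (K : ℕ) (hK : 0 < K) (hKn : K ≤ n)
    (ρ₁ ρ₂ : Dni n χ →ₗ[ℂ] ℂ)
    (hst1 : ∀ (τ σ : Dni n χ) (i : Fin n),
      (σ : Euc n → ℂ) = pd i (τ : Euc n → ℂ) → ρ₁ σ = 0)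
    (hst2 : ∀ (τ σ : Dni n χ) (i : Fin n),
      (σ : Euc n → ℂ) = pd i (τ : Euc n → ℂ) → ρ₂ σ = 0)
    (hagree : ∀ (σ : Dni n χ) (a : ℂ) (σc : ℕ → Euc n → ℂ),
      IsCS χ a (σ : Euc n → ℂ) σc → a.re < -(K : ℝ) → ρ₁ σ = ρ₂ σ) :
    ∀ σ : Dni n χ, ρ₁ σ = ρ₂ σ := by
  have hst : ∀ (τ σ : Dni n χ) (i : Fin n),
      (σ : Euc n → ℂ) = pd i (τ : Euc n → ℂ) → (ρ₁ - ρ₂) σ = 0 := fun τ σ i h => by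
    rw [LinearMap.sub_apply, hst1 τ σ i h, hst2 τ σ i h, sub_zero]
  have hlow : ∀ (σ : Dni n χ) (a : ℂ) (σc : ℕ → Euc n → ℂ),
      IsCS χ a (σ : Euc n → ℂ) σc → a.re < -(K : ℝ) → (ρ₁ - ρ₂) σ = 0 :=
    fun σ a σc h ha => by rw [LinearMap.sub_apply, hagree σ a σc h ha, sub_self]
  have hsm : ∀ σ : Dni n χ, IsSmoothing (σ : Euc n → ℂ) → (ρ₁ - ρ₂) σ = 0 := fun σ h =>
    hlow σ (-(K + 1 : ℝ) : ℝ) _ (h.isCS (by rw [ofReal_re]; linarith [K.cast_nonneg (α := ℝ)])) (by simp)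
  have hall : ∀ (f : Euc n → ℂ) (hf : f ∈ Dni n χ), (ρ₁ - ρ₂) ⟨f, hf⟩ = 0 := by
    intro f hf
    induction hf using Submodule.span_induction with
    | zero => exact map_zero (ρ₁ - ρ₂)
    | add x y hx hy ihx ihy =>
      have := map_add (ρ₁ - ρ₂) (⟨x, hx⟩ : Dni n χ) ⟨y, hy⟩
      rwa [ihx, ihy, add_zero] at this
    | smul c x hx ih =>
      have := map_smul (ρ₁ - ρ₂) c (⟨x, hx⟩ : Dni n χ)
      rwa [ih, smul_zero] at this
    | mem σ hσ =>
      rcases hσ with hσ | ⟨a, σc, hcs, ha⟩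
      · exact hsm _ hσ
      · obtain ⟨N, hN⟩ := exists_nat_gt (a.re + K)
        have hr := hcs.remainder hχ N
        have hrD : _ ∈ Dni n χ :=
          Submodule.subset_span (Or.inr ⟨_, _, hr, not_int_sub_natCast ha N⟩)
        have hcD := fun j => (hcs.homogAtInfty_comp hχ j).mem_Dni hχ
          (hχ.contDiff_mul (hcs.comp_smooth j)) (not_int_sub_natCast ha j)
        have hdec : (⟨σ, Submodule.subset_span (Or.inr ⟨a, σc, hcs, ha⟩)⟩ : Dni n χ) =
            ⟨_, hrD⟩ + ∑ j ∈ Finset.range N, ⟨_, hcD j⟩ := by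
          ext ξ
          simp
        rw [hdec, map_add, map_sum,
          hlow ⟨_, hrD⟩ _ _ hr (by simp only [sub_re, natCast_re]; linarith), zero_add]
        exact Finset.sum_eq_zero fun j _ => (hcs.homogAtInfty_comp hχ j).closed_form_eq_zero hχ
          (ρ₁ - ρ₂) hst hsm (hχ.contDiff_mul (hcs.comp_smooth j)) (not_int_sub_natCast ha j) _
  exact fun σ => sub_eq_zero.1 (hall σ σ.2)


end
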